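/- arXiv:1407.3871 — 3 statements merged into one kernel-verified Lean document; each statement's English description precedes it below -/
import Mathlib

section
/- Let U = [0,1] × [0,1] ⊂ ℝ², let p > 2, and let g : ℝ² → ℝ be continuously differentiable on U and nonconstant on U. Set ‖g‖_{C⁰} = sup_{x ∈ U} |g(x)| and K = sup_{x ∈ U} ‖Dg(x)‖, so K > 0. Then ∫_U |g|^p dA ≥ 2^{-p} · ‖g‖_{C⁰}^p · min { π/4 , π ‖g‖_{C⁰}² / (16 K²) }. -/
open MeasureTheory Real

noncomputable section

/-- The closed unit square `U = [0,1] × [0,1]` in `ℝ²`. -/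
def unitSquare : Set (ℝ × ℝ) := Set.Icc (0 : ℝ) 1 ×ˢ Set.Icc (0 : ℝ) 1

theorem exists_Icc_subset_inter_closedBall {a r : ℝ} (ha : a ∈ Set.Icc (0 : ℝ) 1)
    (hr : r ∈ Set.Icc (0 : ℝ) 1) :
    ∃ c, Set.Icc c (c + r) ⊆ Set.Icc 0 1 ∩ Metric.closedBall a r := by
  obtain ⟨ha0, ha1⟩ := ha
  obtain ⟨hr0, hr1⟩ := hr
  refine ⟨min a (1 - r), fun t ht => ?_⟩
  obtain ⟨h1, h2⟩ := ht
  rw [Set.mem_inter_iff, Set.mem_Icc, Metric.mem_closedBall, Real.dist_eq, abs_le]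
  rcases min_cases a (1 - r) with ⟨h, _⟩ | ⟨h, _⟩ <;> rw [h] at h1 h2 <;>
    refine ⟨⟨?_, ?_⟩, ?_, ?_⟩ <;> linarith

theorem isCompact_unitSquare : IsCompact unitSquare := isCompact_Icc.prod isCompact_Icc

theorem convex_unitSquare : Convex ℝ unitSquare := (convex_Icc 0 1).prod (convex_Icc 0 1)

/-- If `h ≥ c` on the part of the unit square within sup-distance `r ≤ 1` of one of its points,
then `∫_U h ≥ c * r ^ 2`. -/
theorem mul_sq_le_setIntegral_unitSquare {h : ℝ × ℝ → ℝ} {c r : ℝ} {x₀ : ℝ × ℝ}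
    (hint : IntegrableOn h unitSquare) (hnonneg : ∀ x, 0 ≤ h x) (hx₀ : x₀ ∈ unitSquare)
    (hr : r ∈ Set.Icc (0 : ℝ) 1)
    (hc : ∀ x ∈ unitSquare, ‖x - x₀‖ ≤ r → c ≤ h x) :
    c * r ^ 2 ≤ ∫ x in unitSquare, h x := by
  obtain ⟨a, ha⟩ := exists_Icc_subset_inter_closedBall hx₀.1 hr
  obtain ⟨b, hb⟩ := exists_Icc_subset_inter_closedBall hx₀.2 hr
  set S : Set (ℝ × ℝ) := Set.Icc a (a + r) ×ˢ Set.Icc b (b + r) with hS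
  have hSU : S ⊆ unitSquare := fun x hx => ⟨(ha hx.1).1, (hb hx.2).1⟩
  have hSm : MeasurableSet S := measurableSet_Icc.prod measurableSet_Icc
  have hvol : volume.real S = r ^ 2 := by
    rw [hS, Measure.volume_eq_prod, measureReal_prod_prod,
      Real.volume_real_Icc_of_le (by linarith [hr.1]),
      Real.volume_real_Icc_of_le (by linarith [hr.1])]
    ring
  have hfin : volume S ≠ ⊤ := (isCompact_Icc.prod isCompact_Icc).measure_lt_top.ne
  calc c * r ^ 2 = ∫ _ in S, c := by rw [setIntegral_const, hvol, smul_eq_mul, mul_comm]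
    _ ≤ ∫ x in S, h x := by
      refine setIntegral_mono_on (integrableOn_const hfin) (hint.mono_set hSU) hSm
        fun x hx => hc x (hSU hx) ?_
      have h1 := (ha hx.1).2
      have h2 := (hb hx.2).2
      rw [Metric.mem_closedBall, dist_eq_norm] at h1 h2
      exact max_le h1 h2
    _ ≤ ∫ x in unitSquare, h x :=
      setIntegral_mono_set hint (Filter.Eventually.of_forall hnonneg) hSU.eventuallyLE

/-- The integral lower bound from the proof of Lemma A.2: for `g` continuously
differentiable (on a neighborhood of `U`) and nonconstant on `U`,
`∫_U |g|^p ≥ 2^{-p} ‖g‖_{C⁰}^p · min (π/4) (π ‖g‖_{C⁰}² / (16 K²))`,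
where `‖g‖_{C⁰}` and `K` are the sups over `U` of `|g|` and `‖Dg‖`. -/
theorem stmt1 (p : ℝ) (hp : 2 < p) (g : ℝ × ℝ → ℝ)
    (V : Set (ℝ × ℝ)) (hV : IsOpen V) (hUV : unitSquare ⊆ V)
    (hg : ContDiffOn ℝ 1 g V)
    (hnc : ∃ x ∈ unitSquare, ∃ y ∈ unitSquare, g x ≠ g y) :
    (∫ x in unitSquare, |g x| ^ p ∂volume) ≥
      (2 : ℝ) ^ (-p) * (sSup ((fun x => |g x|) '' unitSquare)) ^ p *
        min (π / 4)
          (π * (sSup ((fun x => |g x|) '' unitSquare)) ^ 2 /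
            (16 * (sSup ((fun x => ‖fderiv ℝ g x‖) '' unitSquare)) ^ 2)) := by
  have hdiff : ∀ x ∈ unitSquare, DifferentiableAt ℝ g x := fun x hx =>
    (hg.differentiableOn one_ne_zero).differentiableAt (hV.mem_nhds (hUV hx))
  have hgc : ContinuousOn g unitSquare := hg.continuousOn.mono hUV
  have hDc : ContinuousOn (fun x => ‖fderiv ℝ g x‖) unitSquare :=
    ((hg.continuousOn_fderiv_of_isOpen hV le_rfl).mono hUV).norm
  obtain ⟨y, hy, -⟩ := hnc
  obtain ⟨x₀, hx₀, hM, -⟩ :=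
    isCompact_unitSquare.exists_sSup_image_eq_and_ge ⟨y, hy⟩ hgc.abs
  set M := sSup ((fun x => |g x|) '' unitSquare)
  set K := sSup ((fun x => ‖fderiv ℝ g x‖) '' unitSquare)
  have hK : ∀ x ∈ unitSquare, ‖fderiv ℝ g x‖ ≤ K := fun x hx =>
    le_csSup (isCompact_unitSquare.bddAbove_image hDc) (Set.mem_image_of_mem _ hx)
  have hK0 : 0 ≤ K := (norm_nonneg _).trans (hK y hy)
  have hM0 : 0 ≤ M := hM ▸ abs_nonneg _
  have hr0 : 0 ≤ min 1 (M / (2 * K)) := by positivity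
  have hint : IntegrableOn (fun x => |g x| ^ p) unitSquare :=
    (hgc.abs.rpow_const fun _ _ => Or.inr (by linarith)).integrableOn_compact
      isCompact_unitSquare
  have hKr : K * min 1 (M / (2 * K)) ≤ M / 2 := by
    rcases hK0.eq_or_lt with h | h
    · rw [← h, zero_mul]; positivity
    · calc K * min 1 (M / (2 * K)) ≤ K * (M / (2 * K)) := by gcongr; exact min_le_right _ _
        _ = M / 2 := by field_simp
  have key := mul_sq_le_setIntegral_unitSquare (c := (M / 2) ^ p) hint
    (fun x => by positivity) hx₀ ⟨hr0, min_le_left _ _⟩ fun x hx hxr => by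
      have h1 := convex_unitSquare.norm_image_sub_le_of_norm_fderiv_le hdiff hK hx₀ hx
      have h2 : |g x₀| - |g x| ≤ ‖g x - g x₀‖ := by
        rw [norm_sub_rev]; exact abs_sub_abs_le_abs_sub _ _
      have h3 : K * ‖x - x₀‖ ≤ K * min 1 (M / (2 * K)) := by gcongr
      have h4 : M = |g x₀| := hM
      exact rpow_le_rpow (by positivity) (by linarith) (by linarith)
  refine le_trans ?_ key
  rw [div_rpow hM0 zero_le_two, rpow_neg zero_le_two, ← div_eq_inv_mul]
  gcongr
  have hπ := pi_le_four
  rcases min_cases 1 (M / (2 * K)) with ⟨h, _⟩ | ⟨h, _⟩ <;> rw [h]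
  · exact (min_le_left _ _).trans (by linarith)
  · refine (min_le_right _ _).trans ?_
    have : π * M ^ 2 / (16 * K ^ 2) = π / 4 * (M / (2 * K)) ^ 2 := by
      rw [div_pow, mul_pow, div_mul_div_comm]; ring_nf
    rw [this]
    exact mul_le_of_le_one_left (by positivity) (by linarith)
end
end

section
/- Let U = [0,1] × [0,1] ⊂ ℝ², let p > 2, let g : ℝ² → ℝ be continuously differentiable on U, and let K' be a real number with K' ≥ sup_{x ∈ U} ‖Dg(x)‖. Then either ‖g‖_{C⁰}^{1 + 2/p} ≤ 32 (K')^{2/p} ‖g‖_{L^p(U)}, or ‖g‖_{C⁰} ≤ 4 ‖g‖_{L^p(U)}, where ‖g‖_{C⁰} = sup_{x ∈ U} |g(x)| and ‖g‖_{L^p(U)} = (∫_U |g|^p dA)^{1/p}. -/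
open MeasureTheory Real

noncomputable section

/-- A subinterval of `[0,1]` of length `r`, all of whose points are within `r` of `a`. -/
lemma exists_Icc_subset_unitInterval {a r : ℝ} (ha : a ∈ Set.Icc (0 : ℝ) 1)
    (hr0 : 0 ≤ r) (hr1 : r ≤ 1) :
    ∃ c, Set.Icc c (c + r) ⊆ Set.Icc 0 1 ∧ ∀ y ∈ Set.Icc c (c + r), |y - a| ≤ r := by
  obtain ⟨ha0, ha1⟩ := ha
  rcases le_total a (1 - r) with h | h
  · refine ⟨a, Set.Icc_subset_Icc ha0 (by linarith), fun y hy => ?_⟩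
    rw [abs_le]
    constructor <;> linarith [hy.1, hy.2]
  · refine ⟨1 - r, Set.Icc_subset_Icc (by linarith) (by linarith), fun y hy => ?_⟩
    rw [abs_le]
    constructor <;> linarith [hy.1, hy.2]

/-- If `g` is `K`-Lipschitz on the unit square and `K * r ≤ |g x₀| / 2`, then `|g|` is at least
`|g x₀| / 2` on a subsquare of side `r`, which bounds the `L^p` norm from below. -/
lemma abs_mul_rpow_le_lpNorm_unitSquare {p K r : ℝ} (hp : 0 < p) {g : ℝ × ℝ → ℝ}
    (hg : ContinuousOn g unitSquare) (hK : 0 ≤ K)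
    (hlip : ∀ x ∈ unitSquare, ∀ y ∈ unitSquare, |g y - g x| ≤ K * ‖y - x‖)
    {x₀ : ℝ × ℝ} (hx₀ : x₀ ∈ unitSquare) (hr0 : 0 ≤ r) (hr1 : r ≤ 1)
    (hr : K * r ≤ |g x₀| / 2) :
    |g x₀| / 2 * r ^ (2 / p) ≤ (∫ x in unitSquare, |g x| ^ p ∂volume) ^ (1 / p) := by
  obtain ⟨c, hc, hcr⟩ := exists_Icc_subset_unitInterval hx₀.1 hr0 hr1
  obtain ⟨d, hd, hdr⟩ := exists_Icc_subset_unitInterval hx₀.2 hr0 hr1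
  set Q : Set (ℝ × ℝ) := Set.Icc c (c + r) ×ˢ Set.Icc d (d + r) with hQ
  have hQU : Q ⊆ unitSquare := Set.prod_mono hc hd
  have hQm : MeasurableSet Q := measurableSet_Icc.prod measurableSet_Icc
  have hvol : volume.real Q = r ^ 2 := by
    rw [hQ, Measure.volume_eq_prod, measureReal_prod_prod, Real.volume_real_Icc,
      Real.volume_real_Icc]
    simp [hr0, sq]
  have hint : IntegrableOn (fun x => |g x| ^ p) unitSquare volume :=
    (hg.abs.rpow_const fun _ _ => Or.inr hp.le).integrableOn_compact
      (isCompact_Icc.prod isCompact_Icc)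
  have hlow : ∀ y ∈ Q, |g x₀| / 2 ≤ |g y| := by
    intro y hy
    have hdist : ‖y - x₀‖ ≤ r := max_le (hcr _ hy.1) (hdr _ hy.2)
    have h₁ := hlip x₀ hx₀ y (hQU hy)
    have h₂ := mul_le_mul_of_nonneg_left hdist hK
    have h₃ := abs_sub_abs_le_abs_sub (g x₀) (g y)
    rw [abs_sub_comm] at h₃
    linarith
  have hQint : (|g x₀| / 2) ^ p * r ^ 2 ≤ ∫ x in unitSquare, |g x| ^ p ∂volume := by
    rw [← hvol]
    have hQfin : volume Q ≠ ⊤ := (isCompact_Icc.prod isCompact_Icc).measure_lt_top.ne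
    refine (setIntegral_ge_of_const_le_real hQm hQfin (fun y hy => ?_)
      (hint.mono_set hQU)).trans (setIntegral_mono_set hint ?_ hQU.eventuallyLE)
    · exact rpow_le_rpow (by positivity) (hlow y hy) hp.le
    · exact Filter.Eventually.of_forall fun x => by positivity
  calc |g x₀| / 2 * r ^ (2 / p) = ((|g x₀| / 2) ^ p * r ^ 2) ^ (1 / p) := by
        rw [mul_rpow (by positivity) (by positivity), ← rpow_mul (by positivity),
          mul_one_div_cancel hp.ne', rpow_one, ← rpow_natCast r 2, ← rpow_mul hr0]
        congr 2
        push_cast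
        ring
    _ ≤ _ := rpow_le_rpow (by positivity) hQint (by positivity)

/-- The either-or `C⁰`-versus-`L^p` estimate from the proof of Lemma A.2:
either `‖g‖_{C⁰}^{1+2/p} ≤ 32 (K')^{2/p} ‖g‖_{L^p(U)}` or `‖g‖_{C⁰} ≤ 4 ‖g‖_{L^p(U)}`,
whenever `K'` bounds `‖Dg‖` on `U`. -/
theorem stmt2 (p : ℝ) (hp : 2 < p) (g : ℝ × ℝ → ℝ)
    (V : Set (ℝ × ℝ)) (hV : IsOpen V) (hUV : unitSquare ⊆ V)
    (hg : ContDiffOn ℝ 1 g V) (K' : ℝ)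
    (hK' : ∀ x ∈ unitSquare, ‖fderiv ℝ g x‖ ≤ K') :
    (sSup ((fun x => |g x|) '' unitSquare)) ^ (1 + 2 / p) ≤
        32 * K' ^ (2 / p) * (∫ x in unitSquare, |g x| ^ p ∂volume) ^ (1 / p) ∨
      sSup ((fun x => |g x|) '' unitSquare) ≤
        4 * (∫ x in unitSquare, |g x| ^ p ∂volume) ^ (1 / p) := by
  have hp0 : 0 < p := by linarith
  have hcomp : IsCompact unitSquare := isCompact_Icc.prod isCompact_Icc
  have hconv : Convex ℝ unitSquare := (convex_Icc 0 1).prod (convex_Icc 0 1)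
  have h0 : ((0, 0) : ℝ × ℝ) ∈ unitSquare := by simp [unitSquare]
  have hcont : ContinuousOn g unitSquare := hg.continuousOn.mono hUV
  have hK : 0 ≤ K' := (norm_nonneg _).trans (hK' _ h0)
  have hlip : ∀ x ∈ unitSquare, ∀ y ∈ unitSquare, |g y - g x| ≤ K' * ‖y - x‖ :=
    fun x hx y hy => hconv.norm_image_sub_le_of_norm_fderiv_le
      (fun z hz => (hg.contDiffAt (hV.mem_nhds (hUV hz))).differentiableAt one_ne_zero)
      hK' hx hy
  obtain ⟨x₀, hx₀, hsup⟩ := hcomp.exists_sSup_image_eq ⟨_, h0⟩ hcont.abs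
  rw [hsup]
  have hM : 0 ≤ |g x₀| := abs_nonneg _
  have hLnn : 0 ≤ (∫ x in unitSquare, |g x| ^ p ∂volume) ^ (1 / p) := by positivity
  rcases le_or_gt (2 * K') |g x₀| with h | h
  · right
    have := abs_mul_rpow_le_lpNorm_unitSquare hp0 hcont hK hlip hx₀ zero_le_one le_rfl
      (by linarith)
    rw [one_rpow] at this
    linarith
  · left
    have hKpos : 0 < K' := by linarith
    have key := abs_mul_rpow_le_lpNorm_unitSquare (r := |g x₀| / (2 * K')) hp0 hcont hK hlip hx₀
      (by positivity) ((div_le_one (by positivity)).2 h.le)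
      (by field_simp; rfl)
    have h2p : (2 : ℝ) ^ (2 / p) ≤ 2 := by
      have := rpow_le_rpow_of_exponent_le (one_le_two (α := ℝ))
        ((div_le_one hp0).2 hp.le)
      rwa [rpow_one] at this
    have hKp : 0 < K' ^ (2 / p) := rpow_pos_of_pos hKpos _
    rw [div_rpow hM (by positivity), mul_rpow zero_le_two hK, div_mul_div_comm,
      div_le_iff₀ (by positivity)] at key
    rw [rpow_add_of_nonneg hM zero_le_one (by positivity), rpow_one]
    refine key.trans ?_
    have := mul_le_mul_of_nonneg_right h2p (mul_nonneg hKp.le hLnn)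
    have := mul_nonneg hKp.le hLnn
    linarith
end
end

section
/- There exists a constant C > 0, independent of all the data below, with the following property. Let p > 2 and δ > 0, and let f : ℝ² → ℝ be continuously differentiable on the closed half-strip S⁺ = [0,∞) × [0,1]. Assume M := sup_{(s,t) ∈ S⁺} ‖Df(s,t)‖ < ∞ and A := (∫_{S⁺} |f(s,t)|^p e^{δ s} ds dt)^{1/p} < ∞. Then for every (s,t) ∈ S⁺: |f(s,t)| ≤ C · e^{-δ (s-1)/(p+2)} · (1 + A) · (1 + M). -/
open MeasureTheory Real

noncomputable section

/-- The closed half-strip `S⁺ = [0,∞) × [0,1]` in `ℝ²`. -/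
def halfStrip : Set (ℝ × ℝ) := Set.Ici (0 : ℝ) ×ˢ Set.Icc (0 : ℝ) 1

/-- A set integral of a nonnegative function is at least `c * volume` of any square on which the
function is bounded below by `c`. -/
theorem mul_sq_le_setIntegral_of_square_subset {g : ℝ × ℝ → ℝ} {S : Set (ℝ × ℝ)} {a b r c : ℝ}
    (hr : 0 ≤ r) (hS : MeasurableSet S) (hg : IntegrableOn g S volume) (hg0 : ∀ y ∈ S, 0 ≤ g y)
    (hsub : Set.Icc a (a + r) ×ˢ Set.Icc b (b + r) ⊆ S)
    (hc : ∀ y ∈ Set.Icc a (a + r) ×ˢ Set.Icc b (b + r), c ≤ g y) :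
    c * r ^ 2 ≤ ∫ y in S, g y := by
  have hvol : (volume : Measure (ℝ × ℝ)).real (Set.Icc a (a + r) ×ˢ Set.Icc b (b + r)) = r ^ 2 := by
    rw [Measure.volume_eq_prod, measureReal_prod_prod]
    simp [hr, sq]
  have hfin : volume (Set.Icc a (a + r) ×ˢ Set.Icc b (b + r)) ≠ ⊤ :=
    (isCompact_Icc.prod isCompact_Icc).measure_lt_top.ne
  have h := setIntegral_ge_of_const_le_real (measurableSet_Icc.prod measurableSet_Icc) hfin hc
    (hg.mono_set hsub)
  rw [hvol] at h
  refine h.trans (setIntegral_mono_set hg ?_ hsub.eventuallyLE)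
  exact (ae_restrict_mem hS).mono hg0

theorem convex_halfStrip : Convex ℝ halfStrip := (convex_Ici 0).prod (convex_Icc 0 1)

theorem measurableSet_halfStrip : MeasurableSet halfStrip :=
  measurableSet_Ici.prod measurableSet_Icc

/-- Every point of the half-strip lies in a square of side `r ≤ 1 / 2` inside the half-strip, to the
right of the point. -/
theorem exists_square_subset_halfStrip {x : ℝ × ℝ} (hx : x ∈ halfStrip) {r : ℝ} (hr0 : 0 ≤ r)
    (hr : r ≤ 1 / 2) :
    ∃ b, Set.Icc x.1 (x.1 + r) ×ˢ Set.Icc b (b + r) ⊆ halfStrip ∧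
      x ∈ Set.Icc x.1 (x.1 + r) ×ˢ Set.Icc b (b + r) := by
  obtain ⟨s, t⟩ := x
  simp only [halfStrip, Set.mem_prod, Set.mem_Ici, Set.mem_Icc] at hx
  rcases le_total t (1 / 2) with ht | ht
  · refine ⟨t, ?_, ?_⟩
    · rintro ⟨u, v⟩ h
      simp only [halfStrip, Set.mem_prod, Set.mem_Ici, Set.mem_Icc] at h ⊢
      refine ⟨?_, ?_, ?_⟩ <;> linarith
    · simp [hr0]
  · refine ⟨t - r, ?_, ?_⟩
    · rintro ⟨u, v⟩ h
      simp only [halfStrip, Set.mem_prod, Set.mem_Ici, Set.mem_Icc] at h ⊢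
      refine ⟨?_, ?_, ?_⟩ <;> linarith
    · simp [hr0]

/-- A function with `‖Df‖ ≤ L` on the half-strip is at least `|f x| / 2` on a square of side `r`
with `L * r ≤ |f x| / 2`, which bounds its weighted `L^p` integral from below. -/
theorem rpow_mul_exp_mul_sq_le_setIntegral {p δ L r : ℝ} {f : ℝ × ℝ → ℝ} (hp : 0 ≤ p) (hδ : 0 ≤ δ)
    (hL : 0 ≤ L) (hf : ∀ x ∈ halfStrip, DifferentiableAt ℝ f x)
    (hbd : ∀ x ∈ halfStrip, ‖fderiv ℝ f x‖ ≤ L)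
    (hint : IntegrableOn (fun x => |f x| ^ p * Real.exp (δ * x.1)) halfStrip volume)
    {x : ℝ × ℝ} (hx : x ∈ halfStrip) (hr0 : 0 ≤ r) (hr : r ≤ 1 / 2) (hLr : L * r ≤ |f x| / 2) :
    (|f x| / 2) ^ p * Real.exp (δ * x.1) * r ^ 2 ≤
      ∫ y in halfStrip, |f y| ^ p * Real.exp (δ * y.1) := by
  obtain ⟨b, hsub, hxQ⟩ := exists_square_subset_halfStrip hx hr0 hr
  refine mul_sq_le_setIntegral_of_square_subset hr0 measurableSet_halfStrip hint
    (fun y _ => by positivity) hsub fun y hy => ?_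
  have hlip := convex_halfStrip.norm_image_sub_le_of_norm_fderiv_le hf hbd (hsub hy) hx
  have hdist : ‖x - y‖ ≤ r := by
    simp only [Set.mem_prod, Set.mem_Icc] at hy hxQ
    rw [Prod.norm_def, Prod.fst_sub, Prod.snd_sub, Real.norm_eq_abs, Real.norm_eq_abs]
    refine max_le (abs_le.2 ⟨?_, ?_⟩) (abs_le.2 ⟨?_, ?_⟩) <;> linarith
  have habs : |f x| - |f y| ≤ |f x - f y| := abs_sub_abs_le_abs_sub _ _
  rw [Real.norm_eq_abs] at hlip
  have hlow : |f x| / 2 ≤ |f y| := by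
    have := mul_le_mul_of_nonneg_left hdist hL
    linarith
  have hxy : x.1 ≤ y.1 := hy.1.1
  gcongr

/-- Lemma A.2 (pointwise exponential decay): there is a universal constant `C > 0`
such that any `C¹` function `f` on the half strip with `‖Df‖ ≤ M` and finite
weighted norm `A = ‖f‖_{L^{p;δ}}` satisfies
`|f(s,t)| ≤ C e^{-δ(s-1)/(p+2)} (1 + A)(1 + M)`. -/
theorem stmt3 :
    ∃ C : ℝ, 0 < C ∧
      ∀ (p δ : ℝ) (f : ℝ × ℝ → ℝ) (V : Set (ℝ × ℝ)) (M : ℝ),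
        2 < p → 0 < δ → IsOpen V → halfStrip ⊆ V → ContDiffOn ℝ 1 f V →
        (∀ x ∈ halfStrip, ‖fderiv ℝ f x‖ ≤ M) →
        IntegrableOn (fun x => |f x| ^ p * Real.exp (δ * x.1)) halfStrip volume →
        ∀ x ∈ halfStrip,
          |f x| ≤ C * Real.exp (-δ * (x.1 - 1) / (p + 2)) *
            (1 + (∫ y in halfStrip, |f y| ^ p * Real.exp (δ * y.1) ∂volume) ^ (1 / p)) *
            (1 + M) := by
  refine ⟨32, by norm_num, ?_⟩
  intro p δ f V M hp hδ hV hsub hf hbd hint x hx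
  have hM : 0 ≤ M := (norm_nonneg _).trans (hbd x hx)
  have hs : 0 ≤ x.1 := hx.1
  have hdiff : ∀ y ∈ halfStrip, DifferentiableAt ℝ f y := fun y hy =>
    (hf.differentiableOn one_ne_zero).differentiableAt (hV.mem_nhds (hsub hy))
  have hbd' : ∀ y ∈ halfStrip, ‖fderiv ℝ f y‖ ≤ 1 + M := fun y hy => by linarith [hbd y hy]
  have key := fun r => rpow_mul_exp_mul_sq_le_setIntegral (r := r) (by linarith : 0 ≤ p) hδ.le
    (by linarith : 0 ≤ 1 + M) hdiff hbd' hint hx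
  set I := ∫ y in halfStrip, |f y| ^ p * Real.exp (δ * y.1)
  have hI : 0 ≤ I := setIntegral_nonneg measurableSet_halfStrip fun y _ => by positivity
  set A := I ^ (1 / p)
  have hA : 0 ≤ A := rpow_nonneg hI _
  have hIA : I = A ^ p := by
    rw [← rpow_mul hI, one_div_mul_cancel (by linarith), rpow_one]
  set E := Real.exp (-δ * x.1 / (p + 2)) with hE
  have hE0 : 0 < E := Real.exp_pos _
  have hE1 : E ≤ 1 := Real.exp_le_one_iff.2
    (div_nonpos_of_nonpos_of_nonneg (by nlinarith) (by linarith))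
  have hEp : E ^ (p + 2) * Real.exp (δ * x.1) = 1 := by
    rw [hE, ← Real.exp_mul, div_mul_cancel₀ _ (by linarith), ← Real.exp_add]
    simp
  have hEle : E ≤ Real.exp (-δ * (x.1 - 1) / (p + 2)) := by
    refine Real.exp_le_exp.2 (div_le_div_of_nonneg_right ?_ (by linarith))
    nlinarith
  have hB : 1 ≤ 1 + A := by linarith
  have hL : 1 ≤ 1 + M := by linarith
  have hscaled : ∀ r, 0 ≤ r → r ≤ 1 / 2 → (1 + M) * r ≤ |f x| / 2 →
      (|f x| / 2) ^ p * r ^ 2 ≤ E ^ (p + 2) * A ^ p := by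
    intro r h0 h1 h2
    calc (|f x| / 2) ^ p * r ^ 2
        = E ^ (p + 2) * ((|f x| / 2) ^ p * Real.exp (δ * x.1) * r ^ 2) := by
          linear_combination -((|f x| / 2) ^ p * r ^ 2) * hEp
      _ ≤ E ^ (p + 2) * A ^ p := by
          rw [← hIA]
          exact mul_le_mul_of_nonneg_left (key r h0 h1 h2) (by positivity)
  suffices h : |f x| / 4 ≤ E * (1 + A) * (1 + M) by
    calc |f x| ≤ 32 * E * (1 + A) * (1 + M) := by linarith [abs_nonneg (f x)]
      _ ≤ _ := by gcongr
  rcases le_total |f x| (1 + M) with hc | hc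
  · have h := hscaled (|f x| / 2 / (1 + M)) (by positivity)
      (by rw [div_le_iff₀ (by linarith)]; linarith)
      (by rw [mul_div_cancel₀ _ (by linarith)])
    have h2 : (|f x| / 2) ^ (p + 2) ≤ (E * (1 + A) * (1 + M)) ^ (p + 2) := by
      calc (|f x| / 2) ^ (p + 2)
          = (|f x| / 2) ^ p * (|f x| / 2 / (1 + M)) ^ 2 * (1 + M) ^ 2 := by
            rw [rpow_add_of_nonneg (by positivity) (by linarith) (by norm_num), rpow_two]
            field_simp
        _ ≤ E ^ (p + 2) * A ^ p * (1 + M) ^ 2 := by gcongr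
        _ ≤ E ^ (p + 2) * (1 + A) ^ (p + 2) * (1 + M) ^ (p + 2) := by
            have h3 : A ^ p ≤ (1 + A) ^ (p + 2) :=
              (rpow_le_rpow hA (by linarith) (by linarith)).trans
                (rpow_le_rpow_of_exponent_le hB (by linarith))
            have h4 : (1 + M) ^ 2 ≤ (1 + M) ^ (p + 2) := by
              rw [← rpow_two]
              exact rpow_le_rpow_of_exponent_le hL (by linarith)
            gcongr
        _ = _ := by
            rw [mul_rpow (by positivity) (by positivity), mul_rpow (by positivity) (by positivity)]
    have h5 := (rpow_le_rpow_iff (by positivity) (by positivity) (by linarith)).1 h2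
    linarith [abs_nonneg (f x)]
  · have h := hscaled (1 / 2) (by norm_num) le_rfl (by linarith)
    have h2 : (|f x| / 4) ^ p ≤ (E * A) ^ p := by
      calc (|f x| / 4) ^ p = (|f x| / 2) ^ p * (1 / 2) ^ p := by
            rw [← mul_rpow (by positivity) (by norm_num)]
            ring_nf
        _ ≤ (|f x| / 2) ^ p * (1 / 2) ^ 2 := by
            gcongr
            rw [← rpow_two]
            exact rpow_le_rpow_of_exponent_ge (by norm_num) (by norm_num) hp.le
        _ ≤ E ^ (p + 2) * A ^ p := h
        _ ≤ E ^ p * A ^ p := by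
            have := rpow_le_rpow_of_exponent_ge hE0 hE1 (by linarith : p ≤ p + 2)
            gcongr
        _ = (E * A) ^ p := by rw [mul_rpow hE0.le hA]
    have h3 := (rpow_le_rpow_iff (by positivity) (by positivity) (by linarith)).1 h2
    calc |f x| / 4 ≤ E * A := h3
      _ ≤ E * (1 + A) := by gcongr; linarith
      _ ≤ E * (1 + A) * (1 + M) := le_mul_of_one_le_right (by positivity) hL
end
end
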